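/- Let X and Y be linear orders and let Z := Y ⊕ {Ω} ⊕ X be the linear order placing every element of Y below the new element Ω and Ω below every element of X. Equip T_Y := ε_Z with the support function supp^T_Y(t) := the finite set of y ∈ Y such that ε_y occurs as a subterm of t. Suppose ϑ : T_Y → Y is a Bachmann-Howard collapse. Then the function f : ϑ_X → ε_Z defined recursively by f(0) := 0, f(Ω) := ε_Ω, f(𝔈_x) := ε_x, f(ϑt) := ε_{ϑ(f(t))}, and f(ω^{t₀}+…+ω^{t_n}) := ω^{f(t₀)}+…+ω^{f(t_n)} is strictly increasing. Consequently, if ε_Z is well-founded, then ϑ_X is well-founded. -/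

import Mathlib

/-- Raw terms of the notation system `ε_X`: `0`, `ε_x` for `x ∈ X`, and ω-sums
`ω^{t₀} + … + ω^{t_n}`. -/
inductive EpsTerm (X : Type) : Type where
  | zero : EpsTerm X
  | eps (x : X) : EpsTerm X
  | omega (ts : List (EpsTerm X)) : EpsTerm X

variable {X : Type} [LinearOrder X]

/-- The order `<_{ε_X}` on terms: `0` is least; `ε_x < ε_y` iff `x < y`;
`ε_x < ω^{t₀}+…+ω^{t_m}` iff `ε_x ≤ t₀`; `ω^{t₀}+…+ω^{t_n} < ε_x` iff `t₀ < ε_x`; and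
ω-sums are compared lexicographically on their exponents (a proper initial segment being
smaller). -/
inductive EpsLt : EpsTerm X → EpsTerm X → Prop where
  | zero_eps (x : X) : EpsLt .zero (.eps x)
  | zero_omega (ts : List (EpsTerm X)) : EpsLt .zero (.omega ts)
  | eps_eps {x y : X} : x < y → EpsLt (.eps x) (.eps y)
  | eps_omega_lt {x : X} {t₀ : EpsTerm X} (ts : List (EpsTerm X)) :
      EpsLt (.eps x) t₀ → EpsLt (.eps x) (.omega (t₀ :: ts))
  | eps_omega_eq (x : X) (ts : List (EpsTerm X)) :
      EpsLt (.eps x) (.omega (.eps x :: ts))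
  | omega_eps {x : X} {t₀ : EpsTerm X} (ts : List (EpsTerm X)) :
      EpsLt t₀ (.eps x) → EpsLt (.omega (t₀ :: ts)) (.eps x)
  | omega_nil (t : EpsTerm X) (ts : List (EpsTerm X)) : EpsLt (.omega []) (.omega (t :: ts))
  | omega_head {s t : EpsTerm X} (ss ts : List (EpsTerm X)) :
      EpsLt s t → EpsLt (.omega (s :: ss)) (.omega (t :: ts))
  | omega_tail {ss ts : List (EpsTerm X)} (s : EpsTerm X) :
      EpsLt (.omega ss) (.omega ts) → EpsLt (.omega (s :: ss)) (.omega (s :: ts))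

/-- Well-formed terms of `ε_X`: in an ω-sum with a single exponent the exponent must not be
of the form `ε_x`, and with several exponents they must be weakly decreasing. -/
inductive EpsWF : EpsTerm X → Prop where
  | zero : EpsWF .zero
  | eps (x : X) : EpsWF (.eps x)
  | omega_single (t : EpsTerm X) : EpsWF t → (∀ x : X, t ≠ .eps x) → EpsWF (.omega [t])
  | omega_many (ts : List (EpsTerm X)) : 2 ≤ ts.length → (∀ t ∈ ts, EpsWF t) →
      ts.Chain' (fun a b => EpsLt b a ∨ b = a) → EpsWF (.omega ts)

set_option linter.unusedSectionVars false
set_option linter.unusedVariables false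

inductive ThetaTerm (X : Type) : Type where
  | zero : ThetaTerm X
  | Om : ThetaTerm X
  | E (x : X) : ThetaTerm X
  | th (s : ThetaTerm X) : ThetaTerm X
  | om (ss : List (ThetaTerm X)) : ThetaTerm X

variable {X : Type} [LinearOrder X]

mutual
def tsize : ThetaTerm X → ℕ
  | .zero => 1
  | .Om => 1
  | .E _ => 1
  | .th s => tsize s + 1
  | .om ss => tsizeL ss + 1
def tsizeL : List (ThetaTerm X) → ℕ
  | [] => 0
  | s :: ss => tsize s + tsizeL ss + 1
end

theorem tsize_pos (t : ThetaTerm X) : 1 ≤ tsize t := by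
  cases t <;> simp [tsize]

attribute [local instance] Classical.propDecidable

mutual
/-- The map `s ↦ s*` of the notation system `ϑ_X`, bundled with the (definitional) bound
`tsize s* ≤ tsize s`: `0* = Ω* = (𝔈_x)* = 0`, `(ϑ s)* = ϑ s`, and
`(ω^{s₀}+…+ω^{s_n})* = max_{i≤n} s_i*` (maximum with respect to `<_{ϑ_X}`). -/
noncomputable def thStar : (t : ThetaTerm X) → {u : ThetaTerm X // tsize u ≤ tsize t}
  | .zero => ⟨.zero, le_rfl⟩
  | .Om => ⟨.zero, by simp [tsize]⟩
  | .E _ => ⟨.zero, by simp [tsize]⟩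
  | .th s => ⟨.th s, le_rfl⟩
  | .om ss =>
    match thStarL ss with
    | ⟨u, hu⟩ => ⟨u, by simp only [tsize]; omega⟩

termination_by t => 3 * tsize t + 1
decreasing_by
  all_goals simp only [tsize, tsizeL] at *
  all_goals omega

/-- The maximum (with respect to `<_{ϑ_X}`) of the `*`-values of a list of terms. -/
noncomputable def thStarL : (ss : List (ThetaTerm X)) →
    {u : ThetaTerm X // tsize u ≤ max 1 (tsizeL ss)}
  | [] => ⟨.zero, by simp [tsize, tsizeL]⟩
  | [s] =>
    match thStar s with
    | ⟨u, hu⟩ => ⟨u, by simp only [tsizeL]; omega⟩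
  | s :: t :: ts =>
    match thStar s, thStarL (t :: ts) with
    | ⟨u, hu⟩, ⟨v, hv⟩ =>
      if thLt u v then ⟨v, by have := tsize_pos s; simp only [tsizeL] at *; omega⟩
      else ⟨u, by have := tsize_pos t; simp only [tsizeL] at *; omega⟩

termination_by ss => 3 * tsizeL ss + 2
decreasing_by
  all_goals simp only [tsize, tsizeL] at *
  all_goals omega

/-- The relation `<_{ϑ_X}` on (raw) terms, following the simultaneous recursive definition. -/
noncomputable def thLt : ThetaTerm X → ThetaTerm X → Prop
  | _, .zero => False
  | .zero, _ => True
  | .Om, .Om => False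
  | .Om, .E _ => True
  | .Om, .th _ => False
  | .Om, .om [] => False
  | .Om, .om (t₀ :: _) => thLt .Om t₀ ∨ ThetaTerm.Om = t₀
  | .E _, .Om => False
  | .E x, .E y => x < y
  | .E _, .th _ => False
  | .E _, .om [] => False
  | .E x, .om (t₀ :: _) => thLt (.E x) t₀ ∨ ThetaTerm.E x = t₀
  | .th _, .Om => True
  | .th _, .E _ => True
  | .th s', .th t' =>
      (match thStar s' with
       | ⟨u, hu⟩ => thLt s' t' ∧ thLt u (.th t')) ∨
      (match thStar t' with
       | ⟨v, hv⟩ => thLt (.th s') v ∨ ThetaTerm.th s' = v)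
  | .th _, .om [] => False
  | .th s', .om (t₀ :: _) => thLt (.th s') t₀ ∨ ThetaTerm.th s' = t₀
  | .om [], .Om => False
  | .om [], .E _ => False
  | .om [], .th _ => False
  | .om (s₀ :: _), .Om => thLt s₀ .Om
  | .om (s₀ :: _), .E y => thLt s₀ (.E y)
  | .om (s₀ :: _), .th t' => thLt s₀ (.th t')
  | .om ss, .om ts => thLexLt ss ts

termination_by s t => 3 * (tsize s + tsize t)
decreasing_by
  all_goals simp only [tsize, tsizeL] at *
  all_goals omega

/-- Lexicographic comparison of ω-sums on their lists of exponents: a proper initial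
segment is smaller, and otherwise the first difference decides. -/
noncomputable def thLexLt : List (ThetaTerm X) → List (ThetaTerm X) → Prop
  | [], [] => False
  | [], _ :: _ => True
  | _ :: _, [] => False
  | s :: ss, t :: ts => thLt s t ∨ (s = t ∧ thLexLt ss ts)
termination_by ss ts => 3 * (tsizeL ss + tsizeL ts) + 1
decreasing_by
  all_goals simp only [tsize, tsizeL] at *
  all_goals omega
end

/-- Well-formed terms of the notation system `ϑ_X`: in an ω-sum with a single exponent the
exponent must not be of the form `Ω`, `𝔈_x` or `ϑ s`, and with several exponents they must be
weakly decreasing with respect to `<_{ϑ_X}`. -/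
inductive ThetaWF : ThetaTerm X → Prop where
  | zero : ThetaWF .zero
  | Om : ThetaWF .Om
  | E (x : X) : ThetaWF (.E x)
  | th {s : ThetaTerm X} : ThetaWF s → ThetaWF (.th s)
  | om_single {s : ThetaTerm X} : ThetaWF s → s ≠ .Om → (∀ x : X, s ≠ .E x) →
      (∀ u : ThetaTerm X, s ≠ .th u) → ThetaWF (.om [s])
  | om_many {ss : List (ThetaTerm X)} : 2 ≤ ss.length → (∀ s ∈ ss, ThetaWF s) →
      ss.Chain' (fun a b => thLt b a ∨ b = a) → ThetaWF (.om ss)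


/-- The linear order `Z := Y ⊕ {Ω} ⊕ X`: every element of `Y` lies below the new element
`Ω` (represented by the middle `PUnit` summand), which lies below every element of `X`. -/
def Zord (X Y : Type) : Type := Y ⊕ₗ (PUnit ⊕ₗ X)

noncomputable instance (X Y : Type) [LinearOrder X] [LinearOrder Y] :
    LinearOrder (Zord X Y) := by unfold Zord; infer_instance

/-- The element `Ω` of `Z`. -/
def ZOm (X Y : Type) : Zord X Y := toLex (Sum.inr (toLex (Sum.inl PUnit.unit)))

/-- The support function on `T_Y = ε_Z`: the finite set of `y ∈ Y` such that `ε_y` occurs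
as a subterm. -/
noncomputable def suppE {X Y : Type} [LinearOrder X] [LinearOrder Y] :
    EpsTerm (Zord X Y) → Finset Y
  | .zero => ∅
  | .eps z => match (ofLex z) with
      | Sum.inl y => {y}
      | Sum.inr _ => ∅
  | .omega ts => (ts.attach.map (fun t => suppE t.val)).foldr (· ∪ ·) ∅
termination_by t => sizeOf t
decreasing_by
  have := List.sizeOf_lt_of_mem t.property
  simp only [EpsTerm.omega.sizeOf_spec]
  omega

/-- The function `f : ϑ_X → ε_Z` determined by a collapse `ϑ : ε_Z → Y`:
`f(0) = 0`, `f(Ω) = ε_Ω`, `f(𝔈_x) = ε_x`, `f(ϑ t) = ε_{ϑ(f(t))}`, and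
`f(ω^{t₀}+…+ω^{t_n}) = ω^{f(t₀)}+…+ω^{f(t_n)}`. -/
noncomputable def thToEps {X Y : Type} [LinearOrder X] [LinearOrder Y]
    (θ : EpsTerm (Zord X Y) → Y) : ThetaTerm X → EpsTerm (Zord X Y)
  | .zero => .zero
  | .Om => .eps (ZOm X Y)
  | .E x => .eps (toLex (Sum.inr (toLex (Sum.inr x))))
  | .th t => .eps (toLex (Sum.inl (θ (thToEps θ t))))
  | .om ts => .omega (ts.attach.map (fun t => thToEps θ t.val))
termination_by t => sizeOf t
decreasing_by
  all_goals simp only [ThetaTerm.th.sizeOf_spec, ThetaTerm.om.sizeOf_spec]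
  · omega
  · have := List.sizeOf_lt_of_mem t.property
    omega

section ThetaOrder

variable {A : Type} [LinearOrder A]

theorem thStar_zero : (thStar (.zero : ThetaTerm A)).1 = .zero := by simp only [thStar]

theorem thStar_Om : (thStar (.Om : ThetaTerm A)).1 = .zero := by simp only [thStar]

theorem thStar_E (x : A) : (thStar (.E x)).1 = .zero := by simp only [thStar]

theorem thStar_th (s : ThetaTerm A) : (thStar (.th s)).1 = .th s := by simp only [thStar]

theorem thStar_om (ss : List (ThetaTerm A)) : (thStar (.om ss)).1 = (thStarL ss).1 := by
  simp only [thStar]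

theorem thStarL_nil : (thStarL ([] : List (ThetaTerm A))).1 = .zero := by simp only [thStarL]

theorem thStarL_singleton (s : ThetaTerm A) : (thStarL [s]).1 = (thStar s).1 := by
  simp only [thStarL]

theorem thStarL_cons_cons (s t : ThetaTerm A) (ts : List (ThetaTerm A)) :
    (thStarL (s :: t :: ts)).1 =
      if thLt (thStar s).1 (thStarL (t :: ts)).1 then (thStarL (t :: ts)).1
      else (thStar s).1 := by
  rw [thStarL]
  rcases thStar s with ⟨u, hu⟩
  rcases thStarL (t :: ts) with ⟨v, hv⟩
  exact apply_ite Subtype.val _ _ _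

theorem thLt_th_th (s t : ThetaTerm A) :
    thLt (.th s) (.th t) ↔ (thLt s t ∧ thLt (thStar s).1 (.th t)) ∨
      (thLt (.th s) (thStar t).1 ∨ .th s = (thStar t).1) := by
  rw [thLt]

theorem thLt_om_om (ss ts : List (ThetaTerm A)) :
    thLt (.om ss) (.om ts) ↔ thLexLt ss ts := by
  cases ss <;> cases ts <;> simp only [thLt]

theorem tsize_lt_tsizeL {s : ThetaTerm A} {ss : List (ThetaTerm A)} (h : s ∈ ss) :
    tsize s < tsizeL ss := by
  induction ss with
  | nil => simp at h
  | cons a l ih =>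
    simp only [tsizeL]
    rcases List.mem_cons.1 h with rfl | h
    · omega
    · have := ih h
      omega

theorem ThetaWF.of_mem {ss : List (ThetaTerm A)} (h : ThetaWF (.om ss)) :
    ∀ s ∈ ss, ThetaWF s := by
  cases h with
  | om_single h => simpa using h
  | om_many _ h _ => exact h

theorem ThetaWF.ne_nil {ss : List (ThetaTerm A)} (h : ThetaWF (.om ss)) : ss ≠ [] := by
  cases h with
  | om_single h => simp
  | om_many h _ _ => rintro rfl; simp at h

theorem ThetaWF.of_th {s : ThetaTerm A} (h : ThetaWF (.th s)) : ThetaWF s := by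
  cases h; assumption

/-- The value `s*` of a list is the zero term or `t*` for some entry `t`. -/
theorem thStarL_eq (ss : List (ThetaTerm A)) :
    (thStarL ss).1 = .zero ∨ ∃ s ∈ ss, (thStarL ss).1 = (thStar s).1 := by
  induction ss with
  | nil => exact .inl thStarL_nil
  | cons s l ih =>
    cases l with
    | nil => exact .inr ⟨s, by simp, thStarL_singleton s⟩
    | cons t ts =>
      rw [thStarL_cons_cons]
      split_ifs
      · rcases ih with h | ⟨u, hu, h⟩
        · exact .inl h
        · exact .inr ⟨u, List.mem_cons_of_mem _ hu, h⟩
      · exact .inr ⟨s, by simp, rfl⟩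

theorem thStarL_spec {p : ThetaTerm A → Prop} (h0 : p .zero) {ss : List (ThetaTerm A)}
    (h : ∀ s ∈ ss, p (thStar s).1) : p (thStarL ss).1 := by
  rcases thStarL_eq ss with e | ⟨s, hs, e⟩
  · rwa [e]
  · rw [e]; exact h s hs

theorem ThetaWF.thStar {s : ThetaTerm A} (h : ThetaWF s) : ThetaWF (thStar s).1 := by
  induction h with
  | zero => rw [thStar_zero]; exact .zero
  | Om => rw [thStar_Om]; exact .zero
  | E x => rw [thStar_E]; exact .zero
  | th h _ => rw [thStar_th]; exact .th h
  | om_single _ _ _ _ ih => rw [thStar_om, thStarL_singleton]; exact ih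
  | om_many _ _ _ ih => rw [thStar_om]; exact thStarL_spec .zero ih

theorem thLexLt_trichotomy {ss ts : List (ThetaTerm A)}
    (h : ∀ s ∈ ss, ∀ t ∈ ts, thLt s t ∨ s = t ∨ thLt t s) :
    thLexLt ss ts ∨ ss = ts ∨ thLexLt ts ss := by
  induction ss generalizing ts with
  | nil => cases ts <;> simp [thLexLt]
  | cons s ss ih =>
    cases ts with
    | nil => simp [thLexLt]
    | cons t ts =>
      simp only [thLexLt]
      have h1 := h s (by simp) t (by simp)
      have h2 := ih (ts := ts) fun a ha b hb => h a (by simp [ha]) b (by simp [hb])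
      grind

/-- The order on well-formed terms of `ϑ_A` is total. -/
theorem thLt_trichotomy {s t : ThetaTerm A} (hs : ThetaWF s) (ht : ThetaWF t) :
    thLt s t ∨ s = t ∨ thLt t s := by
  induction hn : tsize s + tsize t using Nat.strong_induction_on generalizing s t with
  | _ n ih =>
  subst hn
  have head : ∀ {a : ThetaTerm A} {l : List (ThetaTerm A)} {u : ThetaTerm A},
      ThetaWF (.om (a :: l)) → ThetaWF u →
      tsize (.om (a :: l)) + tsize u ≤ tsize s + tsize t → thLt u a ∨ u = a ∨ thLt a u := by
    intro a l u ha hu hle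
    refine ih _ ?_ hu (ha.of_mem a (by simp)) rfl
    simp only [tsize, tsizeL] at hle
    omega
  match s, t with
  | .zero, .zero => simp
  | .zero, .Om | .zero, .E _ | .zero, .th _ | .zero, .om _ => simp [thLt]
  | .Om, .zero | .E _, .zero | .th _, .zero | .om _, .zero => simp [thLt]
  | .Om, .Om | .Om, .E _ | .Om, .th _ | .E _, .Om | .E _, .th _ | .th _, .Om
  | .th _, .E _ => simp [thLt]
  | .E x, .E y => simpa [thLt] using lt_trichotomy x y
  | .Om, .om [] | .E _, .om [] | .th _, .om [] => exact absurd rfl ht.ne_nil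
  | .om [], .Om | .om [], .E _ | .om [], .th _ => exact absurd rfl hs.ne_nil
  | .Om, .om (a :: l) | .E _, .om (a :: l) | .th _, .om (a :: l) =>
    have := head ht hs (by omega)
    simp only [thLt]
    tauto
  | .om (a :: l), .Om | .om (a :: l), .E _ | .om (a :: l), .th _ =>
    have := head hs ht (by omega)
    simp only [thLt]
    tauto
  | .om ss, .om ts =>
    simp only [thLt_om_om, ThetaTerm.om.injEq]
    refine thLexLt_trichotomy fun a ha b hb => ih _ ?_ (hs.of_mem a ha) (ht.of_mem b hb) rfl
    have := tsize_lt_tsizeL ha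
    have := tsize_lt_tsizeL hb
    simp only [tsize]
    omega
  | .th a, .th b =>
    have ha := (thStar a).2
    have hb := (thStar b).2
    have h1 := ih _ (by simp only [tsize]; omega) hs.of_th ht.of_th rfl
    have h2 := ih (tsize (thStar a).1 + tsize (.th b)) (by simp only [tsize]; omega)
      hs.of_th.thStar ht rfl
    have h3 := ih (tsize (thStar b).1 + tsize (.th a)) (by simp only [tsize]; omega)
      ht.of_th.thStar hs rfl
    simp only [thLt_th_th, ThetaTerm.th.injEq]
    clear ih head ha hb
    grind

end ThetaOrder

section Collapse

variable {A B : Type} [LinearOrder A] [LinearOrder B]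

theorem mem_suppE_omega {y : B} {ts : List (EpsTerm (Zord A B))} :
    y ∈ suppE (.omega ts) ↔ ∃ t ∈ ts, y ∈ suppE t := by
  rw [suppE, List.map_attach_eq_pmap, List.pmap_eq_map]
  induction ts with
  | nil => simp
  | cons t ts ih => simp [ih]

theorem mem_suppE_eps_inl {y z : B} :
    y ∈ suppE (.eps (toLex (Sum.inl z)) : EpsTerm (Zord A B)) ↔ y = z := by
  rw [suppE.eq_def]
  exact Finset.mem_singleton

theorem suppE_eps_inr (w : PUnit ⊕ₗ A) :
    suppE (.eps (toLex (Sum.inr w)) : EpsTerm (Zord A B)) = ∅ := by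
  rw [suppE.eq_def]
  rfl

variable (θ : EpsTerm (Zord A B) → B)

theorem thToEps_om (ts : List (ThetaTerm A)) :
    thToEps θ (.om ts) = .omega (ts.map (thToEps θ)) := by
  rw [thToEps, List.map_attach_eq_pmap, List.pmap_eq_map]

theorem mem_suppE_thToEps_om {y : B} {ss : List (ThetaTerm A)} :
    y ∈ suppE (thToEps θ (.om ss)) ↔ ∃ s ∈ ss, y ∈ suppE (thToEps θ s) := by
  simp [thToEps_om, mem_suppE_omega]

theorem thToEps_eq_eps {s : ThetaTerm A} {z : Zord A B} (h : thToEps θ s = .eps z) :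
    s = .Om ∨ (∃ x, s = .E x) ∨ ∃ u, s = .th u := by
  cases s <;> simp [thToEps] at h ⊢

/-- `s*` is the zero term or a collapse whose value lies in the support of the image of `s`. -/
theorem thStar_eq_zero_or_mem_suppE {s : ThetaTerm A} (hs : ThetaWF s) :
    (thStar s).1 = .zero ∨
      ∃ u, (thStar s).1 = .th u ∧ θ (thToEps θ u) ∈ suppE (thToEps θ s) := by
  have list : ∀ {ss : List (ThetaTerm A)},
      (∀ s ∈ ss, (thStar s).1 = .zero ∨
        ∃ u, (thStar s).1 = .th u ∧ θ (thToEps θ u) ∈ suppE (thToEps θ s)) →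
      (thStar (.om ss)).1 = .zero ∨
        ∃ u, (thStar (.om ss)).1 = .th u ∧ θ (thToEps θ u) ∈ suppE (thToEps θ (.om ss)) := by
    intro ss ih
    rw [thStar_om]
    rcases thStarL_eq ss with e | ⟨s, hs, e⟩
    · exact .inl e
    · rw [e]
      refine (ih s hs).imp_right fun ⟨u, hu, h⟩ => ⟨u, hu, ?_⟩
      exact (mem_suppE_thToEps_om θ).2 ⟨s, hs, h⟩
  induction hs with
  | zero => exact .inl thStar_zero
  | Om => exact .inl thStar_Om
  | E x => exact .inl (thStar_E x)
  | @th s _ _ =>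
    refine .inr ⟨s, thStar_th s, ?_⟩
    rw [thToEps, mem_suppE_eps_inl]
  | om_single _ _ _ _ ih => exact list (by simpa using ih)
  | om_many _ _ _ ih => exact list ih

/-- `thToEps θ` is strictly increasing on pairs of well-formed terms of total size at most `n`. -/
def ThToEpsMonoUpTo (n : ℕ) : Prop :=
  ∀ s t : ThetaTerm A, ThetaWF s → ThetaWF t → tsize s + tsize t ≤ n → thLt s t →
    EpsLt (thToEps θ s) (thToEps θ t)

variable {θ} {n : ℕ}

theorem ThToEpsMonoUpTo.mono {m : ℕ} (h : ThToEpsMonoUpTo θ n) (hm : m ≤ n) :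
    ThToEpsMonoUpTo θ m :=
  fun s t hs ht hst => h s t hs ht (hst.trans hm)

theorem eps_inl_lt_iff {y z : B} :
    EpsLt (.eps (toLex (Sum.inl y)) : EpsTerm (Zord A B)) (.eps (toLex (Sum.inl z))) ↔ y < z := by
  constructor
  · rintro (_ | _ | h)
    exact Sum.Lex.inl_lt_inl_iff.1 h
  · exact fun h => .eps_eps (Sum.Lex.inl_lt_inl_iff.2 h)

theorem isChain_map_thToEps (hm : ThToEpsMonoUpTo θ n) {ss : List (ThetaTerm A)}
    (hs : tsizeL ss ≤ n) (hw : ∀ s ∈ ss, ThetaWF s)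
    (hc : ss.IsChain (fun a b => thLt b a ∨ b = a)) :
    (ss.map (thToEps θ)).IsChain (fun a b => EpsLt b a ∨ b = a) := by
  induction hc with
  | nil => exact .nil
  | singleton a => exact .singleton _
  | @cons_cons a b l hab _ ih =>
    have ha := hw a (by simp)
    have hb := hw b (by simp)
    simp only [tsizeL] at hs ih
    refine .cons_cons (hab.imp (hm b a hb ha (by omega)) (congrArg _)) (ih (by omega) ?_)
    exact fun s h => hw s (List.mem_cons_of_mem _ h)

theorem ThToEpsMonoUpTo.epsWF (hm : ThToEpsMonoUpTo θ n) {s : ThetaTerm A} (hs : ThetaWF s)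
    (hn : tsize s ≤ n) : EpsWF (thToEps θ s) := by
  induction hs with
  | zero => rw [thToEps]; exact .zero
  | Om => rw [thToEps]; exact .eps _
  | E x => rw [thToEps]; exact .eps _
  | th _ _ => rw [thToEps]; exact .eps _
  | om_single _ h1 h2 h3 ih =>
    rw [thToEps_om]
    simp only [tsize, tsizeL] at hn
    refine .omega_single _ (ih (by omega)) fun x hx => ?_
    rcases thToEps_eq_eps θ hx with e | ⟨x, e⟩ | ⟨u, e⟩
    exacts [h1 e, h2 x e, h3 u e]
  | @om_many ss hl hw hc ih =>
    rw [thToEps_om]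
    simp only [tsize] at hn
    refine .omega_many _ (by simpa using hl) ?_ (isChain_map_thToEps hm (by omega) hw hc)
    simp only [List.mem_map, forall_exists_index, and_imp, forall_apply_eq_imp_iff₂]
    intro s h
    have := tsize_lt_tsizeL h
    exact ih s h (by omega)

/-- Every element of the support of the image of `s` is bounded by the value of `s*`. -/
theorem ThToEpsMonoUpTo.le_of_mem_suppE (hm : ThToEpsMonoUpTo θ n) {s : ThetaTerm A}
    (hs : ThetaWF s) (hn : tsize s ≤ n) {y : B} (hy : y ∈ suppE (thToEps θ s)) :
    ∃ u, (thStar s).1 = .th u ∧ y ≤ θ (thToEps θ u) := by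
  have list : ∀ {ss : List (ThetaTerm A)}, (∀ s ∈ ss, ThetaWF s) → tsizeL ss ≤ n →
      (∀ s ∈ ss, y ∈ suppE (thToEps θ s) → ∃ u, (thStar s).1 = .th u ∧ y ≤ θ (thToEps θ u)) →
      (∃ s ∈ ss, y ∈ suppE (thToEps θ s)) →
      ∃ u, (thStarL ss).1 = .th u ∧ y ≤ θ (thToEps θ u) := by
    intro ss hw hn ih hy
    induction ss with
    | nil => simp at hy
    | cons s l ihl =>
      cases l with
      | nil =>
        rw [thStarL_singleton]
        exact ih s (by simp) (by simpa using hy)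
      | cons t ts =>
        have hsw := hw s (by simp)
        have hw' : ∀ a ∈ t :: ts, ThetaWF a := fun a h => hw a (List.mem_cons_of_mem _ h)
        have hu := hsw.thStar
        have hv : ThetaWF (thStarL (t :: ts)).1 :=
          thStarL_spec .zero fun a h => (hw' a h).thStar
        have hsz : tsize (thStar s).1 + tsize (thStarL (t :: ts)).1 ≤ n := by
          have h1 := (thStar s).2
          have h2 := (thStarL (t :: ts)).2
          simp only [tsizeL] at hn h2
          have := tsize_pos t
          omega
        have hor : (∃ u, (thStar s).1 = .th u ∧ y ≤ θ (thToEps θ u)) ∨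
            ∃ u, (thStarL (t :: ts)).1 = .th u ∧ y ≤ θ (thToEps θ u) := by
          obtain ⟨a, ha, hya⟩ := hy
          rcases List.mem_cons.1 ha with rfl | ha
          · exact .inl (ih a (by simp) hya)
          · refine .inr (ihl hw' ?_ (fun a h => ih a (List.mem_cons_of_mem _ h)) ⟨a, ha, hya⟩)
            simp only [tsizeL] at hn ⊢
            omega
        have up : ∀ {a b : ThetaTerm A}, ThetaWF a → ThetaWF b → tsize a + tsize b ≤ n →
            (∃ u, a = .th u ∧ y ≤ θ (thToEps θ u)) → thLt a b →
            (b = .zero ∨ ∃ u, b = .th u) → ∃ u, b = .th u ∧ y ≤ θ (thToEps θ u) := by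
          rintro _ _ ha hb hab ⟨u, rfl, hyu⟩ hlt (rfl | ⟨v, rfl⟩)
          · simp [thLt] at hlt
          · refine ⟨v, rfl, hyu.trans (le_of_lt ?_)⟩
            have := hm _ _ ha hb hab hlt
            rwa [thToEps, thToEps, eps_inl_lt_iff] at this
        have form : ∀ a ∈ s :: t :: ts, (thStar a).1 = .zero ∨ ∃ u, (thStar a).1 = .th u :=
          fun a h => (thStar_eq_zero_or_mem_suppE θ (hw a h)).imp_right
            fun ⟨u, hu, _⟩ => ⟨u, hu⟩
        have formL : (thStarL (t :: ts)).1 = .zero ∨ ∃ u, (thStarL (t :: ts)).1 = .th u :=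
          thStarL_spec (p := fun a => a = .zero ∨ ∃ u, a = .th u) (.inl rfl)
            fun a h => form a (List.mem_cons_of_mem _ h)
        rw [thStarL_cons_cons]
        split_ifs with hlt
        · exact hor.elim (fun h => up hu hv hsz h hlt formL) id
        · refine hor.elim id fun h => ?_
          rcases thLt_trichotomy hu hv with h' | h' | h'
          · exact absurd h' hlt
          · rwa [h']
          · exact up hv hu (by omega) h h' (form s (by simp))
  induction hs with
  | zero => simp [thToEps, suppE] at hy
  | Om => simp [thToEps, ZOm, suppE_eps_inr] at hy
  | E x => simp [thToEps, suppE_eps_inr] at hy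
  | @th s _ _ =>
    rw [thToEps, mem_suppE_eps_inl] at hy
    exact ⟨s, thStar_th s, hy.le⟩
  | om_single hw _ _ _ ih =>
    rw [thStar_om]
    simp only [tsize] at hn
    refine list (by simpa using hw) (by omega) ?_ ((mem_suppE_thToEps_om θ).1 hy)
    simp only [List.mem_singleton, forall_eq]
    exact ih (by simp only [tsizeL] at hn; omega)
  | om_many _ hw _ ih =>
    rw [thStar_om]
    simp only [tsize] at hn
    refine list hw (by omega) (fun s h => ih s h ?_) ((mem_suppE_thToEps_om θ).1 hy)
    have := tsize_lt_tsizeL h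
    omega

theorem epsLt_omega_map {ss ts : List (ThetaTerm A)}
    (h : ∀ s ∈ ss, ∀ t ∈ ts, thLt s t → EpsLt (thToEps θ s) (thToEps θ t))
    (hlt : thLexLt ss ts) :
    EpsLt (.omega (ss.map (thToEps θ))) (.omega (ts.map (thToEps θ))) := by
  induction ss generalizing ts with
  | nil =>
    cases ts with
    | nil => simp [thLexLt] at hlt
    | cons t ts => exact .omega_nil _ _
  | cons s ss ih =>
    cases ts with
    | nil => simp [thLexLt] at hlt
    | cons t ts =>
      rw [thLexLt] at hlt
      rcases hlt with hlt | ⟨rfl, hlt⟩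
      · exact .omega_head _ _ (h s (by simp) t (by simp) hlt)
      · exact .omega_tail _
          (ih (fun a ha b hb => h a (by simp [ha]) b (by simp [hb])) hlt)

theorem thToEps_th_lt_th
    (hθ₁ : ∀ σ τ : EpsTerm (Zord A B), EpsWF σ → EpsWF τ → EpsLt σ τ →
      (∀ y ∈ suppE σ, y < θ τ) → θ σ < θ τ)
    (hθ₂ : ∀ σ : EpsTerm (Zord A B), EpsWF σ → ∀ y ∈ suppE σ, y < θ σ)
    {s t : ThetaTerm A} (hm : ThToEpsMonoUpTo θ (tsize s + tsize t + 1))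
    (hs : ThetaWF s) (ht : ThetaWF t) (h : thLt (.th s) (.th t)) :
    EpsLt (thToEps θ (.th s)) (thToEps θ (.th t)) := by
  have hfs := hm.epsWF hs (by omega)
  have hft := hm.epsWF ht (by omega)
  have hs' := (thStar s).2
  have ht' := (thStar t).2
  rw [thToEps, thToEps, eps_inl_lt_iff]
  rw [thLt_th_th] at h
  rcases h with ⟨hst, hstar⟩ | h
  · refine hθ₁ _ _ hfs hft (hm s t hs ht (by omega) hst) fun y hy => ?_
    obtain ⟨u, hu, hyu⟩ := hm.le_of_mem_suppE hs (by omega) hy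
    have := hm _ _ hs.thStar (.th ht) (by simp only [tsize]; omega) hstar
    rw [hu, thToEps, thToEps, eps_inl_lt_iff] at this
    exact hyu.trans_lt this
  · rcases thStar_eq_zero_or_mem_suppE θ ht with e | ⟨u, hu, hmem⟩
    · simp [e, thLt] at h
    · refine lt_of_le_of_lt ?_ (hθ₂ _ hft _ hmem)
      rcases h with h | h
      · have := hm _ _ (.th hs) ht.thStar (by simp only [tsize]; omega) h
        rw [hu, thToEps, thToEps, eps_inl_lt_iff] at this
        exact this.le
      · rw [hu, ThetaTerm.th.injEq] at h
        rw [h]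

theorem thToEpsMonoUpTo_of_collapse
    (hθ₁ : ∀ σ τ : EpsTerm (Zord A B), EpsWF σ → EpsWF τ → EpsLt σ τ →
      (∀ y ∈ suppE σ, y < θ τ) → θ σ < θ τ)
    (hθ₂ : ∀ σ : EpsTerm (Zord A B), EpsWF σ → ∀ y ∈ suppE σ, y < θ σ) (n : ℕ) :
    ThToEpsMonoUpTo θ n := by
  induction n with
  | zero =>
    intro s t _ _ hn
    have := tsize_pos s
    omega
  | succ n ih =>
  intro s t hs ht hn hlt
  have eps_head : ∀ {z : Zord A B} {u a : ThetaTerm A} {l : List (ThetaTerm A)},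
      thToEps θ u = .eps z → ThetaWF u → ThetaWF (.om (a :: l)) →
      tsize u + tsize (.om (a :: l)) ≤ n + 1 → thLt u a ∨ u = a →
      EpsLt (thToEps θ u) (thToEps θ (.om (a :: l))) := by
    intro z u a l hz hu ha hle h
    rw [hz, thToEps_om, List.map_cons]
    rcases h with h | rfl
    · refine .eps_omega_lt _ ?_
      rw [← hz]
      refine ih _ _ hu (ha.of_mem a (by simp)) ?_ h
      simp only [tsize, tsizeL] at hle
      omega
    · rw [hz]
      exact .eps_omega_eq _ _
  have head_eps : ∀ {z : Zord A B} {u a : ThetaTerm A} {l : List (ThetaTerm A)},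
      thToEps θ u = .eps z → ThetaWF u → ThetaWF (.om (a :: l)) →
      tsize (.om (a :: l)) + tsize u ≤ n + 1 → thLt a u →
      EpsLt (thToEps θ (.om (a :: l))) (thToEps θ u) := by
    intro z u a l hz hu ha hle h
    rw [hz, thToEps_om, List.map_cons]
    refine .omega_eps _ ?_
    rw [← hz]
    refine ih _ _ (ha.of_mem a (by simp)) hu ?_ h
    simp only [tsize, tsizeL] at hle
    omega
  match s, t with
  | .zero, .zero | .Om, .zero | .E _, .zero | .th _, .zero | .om _, .zero => simp [thLt] at hlt
  | .zero, .Om | .zero, .E _ | .zero, .th _ =>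
    rw [thToEps, thToEps]
    exact .zero_eps _
  | .zero, .om _ =>
    rw [thToEps, thToEps]
    exact .zero_omega _
  | .Om, .Om | .Om, .th _ | .E _, .Om | .E _, .th _ => simp [thLt] at hlt
  | .Om, .om [] | .E _, .om [] | .th _, .om [] => exact absurd rfl ht.ne_nil
  | .om [], .Om | .om [], .E _ | .om [], .th _ => exact absurd rfl hs.ne_nil
  | .Om, .E _ =>
    rw [thToEps, thToEps]
    exact .eps_eps (Sum.Lex.inr_lt_inr_iff.2 (Sum.Lex.inl_lt_inr _ _))
  | .E x, .E y =>
    rw [thLt] at hlt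
    rw [thToEps, thToEps]
    exact .eps_eps (Sum.Lex.inr_lt_inr_iff.2 (Sum.Lex.inr_lt_inr_iff.2 hlt))
  | .th _, .Om | .th _, .E _ =>
    rw [thToEps, thToEps]
    exact .eps_eps (Sum.Lex.inl_lt_inr _ _)
  | .Om, .om (a :: l) | .E _, .om (a :: l) | .th _, .om (a :: l) =>
    rw [thLt] at hlt
    exact eps_head (by unfold thToEps; rfl) hs ht hn hlt
  | .om (a :: l), .Om | .om (a :: l), .E _ | .om (a :: l), .th _ =>
    rw [thLt] at hlt
    exact head_eps (by unfold thToEps; rfl) ht hs hn hlt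
  | .om ss, .om ts =>
    rw [thToEps_om, thToEps_om]
    refine epsLt_omega_map (fun a ha b hb => ih a b (hs.of_mem a ha) (ht.of_mem b hb) ?_)
      ((thLt_om_om ss ts).1 hlt)
    have := tsize_lt_tsizeL ha
    have := tsize_lt_tsizeL hb
    simp only [tsize] at hn
    omega
  | .th a, .th b =>
    refine thToEps_th_lt_th hθ₁ hθ₂ (ih.mono ?_) hs.of_th ht.of_th hlt
    simp only [tsize] at hn
    omega

end Collapse

/-- Let `X`, `Y` be linear orders, `Z := Y ⊕ {Ω} ⊕ X`, and equip `T_Y := ε_Z`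
with the support function assigning to a term the finite set of `y ∈ Y` with `ε_y` a subterm.
If `ϑ : T_Y → Y` is a Bachmann-Howard collapse, then the function `f : ϑ_X → ε_Z` defined
above is strictly increasing. Consequently, if `ε_Z` is well-founded, then `ϑ_X` is
well-founded. -/
theorem thToEps_strictMono_and_wf (X Y : Type) [LinearOrder X] [LinearOrder Y]
    (θ : EpsTerm (Zord X Y) → Y)
    (hθ₁ : ∀ σ τ : EpsTerm (Zord X Y), EpsWF σ → EpsWF τ → EpsLt σ τ →
      (∀ y ∈ suppE σ, y < θ τ) → θ σ < θ τ)
    (hθ₂ : ∀ σ : EpsTerm (Zord X Y), EpsWF σ → ∀ y ∈ suppE σ, y < θ σ) :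
    (∀ s t : ThetaTerm X, ThetaWF s → ThetaWF t → thLt s t →
      EpsLt (thToEps θ s) (thToEps θ t)) ∧
    (WellFounded (fun a b : {t : EpsTerm (Zord X Y) // EpsWF t} => EpsLt a.val b.val) →
      WellFounded (fun a b : {t : ThetaTerm X // ThetaWF t} => thLt a.val b.val)) := by
  have mono : ∀ s t : ThetaTerm X, ThetaWF s → ThetaWF t → thLt s t →
      EpsLt (thToEps θ s) (thToEps θ t) :=
    fun s t hs ht => thToEpsMonoUpTo_of_collapse hθ₁ hθ₂ _ s t hs ht le_rfl
  refine ⟨mono, fun hwf => ?_⟩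
  let F : {t : ThetaTerm X // ThetaWF t} → {t : EpsTerm (Zord X Y) // EpsWF t} := fun t =>
    ⟨thToEps θ t.1, (thToEpsMonoUpTo_of_collapse hθ₁ hθ₂ _).epsWF t.2 le_rfl⟩
  exact Subrelation.wf (fun {a b} h => mono a.1 b.1 a.2 b.2 h) (InvImage.wf F hwf)
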